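/- (Contraction of the harmonic square with a stress tensor.) Let h be a traceless symmetric real 3×3 matrix and let σ be a symmetric real 3×3 matrix with deviator σ′ = σ − (1/3)(tr σ) Id. Define the fourth-order tensor H with components H_{ijkl} = (1/24) Σ_{π ∈ S₄} T_{π(i)π(j)π(k)π(l)}, the total symmetrization of T_{ijkl} = h_{ij}h_{kl} − (4/7)δ_{ij}(h²)_{kl} + (2/35)tr(h²)δ_{ij}δ_{kl} (this H is the harmonic square h ∗ h). Then Σ_{i,j,k,l} H_{ijkl} σ_{ij} σ_{kl} = (1/3)(tr(hσ′))² + (2/3)tr(σ′hσ′h) − (8/21)tr(h²σ′²) + (4/105)tr(h²) tr(σ′²). -/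

import Mathlib

open Matrix

theorem sum_perm_fin_four {M : Type*} [AddCommMonoid M] (f : Fin 4 → Fin 4 → Fin 4 → Fin 4 → M) :
    ∑ π : Equiv.Perm (Fin 4), f (π 0) (π 1) (π 2) (π 3) =
      (f 0 1 2 3 + f 0 1 3 2 + f 0 2 1 3 + f 0 2 3 1 + f 0 3 1 2 + f 0 3 2 1) +
      (f 1 0 2 3 + f 1 0 3 2 + f 1 2 0 3 + f 1 2 3 0 + f 1 3 0 2 + f 1 3 2 0) +
      (f 2 0 1 3 + f 2 0 3 1 + f 2 1 0 3 + f 2 1 3 0 + f 2 3 0 1 + f 2 3 1 0) +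
      (f 3 0 1 2 + f 3 0 2 1 + f 3 1 0 2 + f 3 1 2 0 + f 3 2 0 1 + f 3 2 1 0) := by
  have map_univ_eq : (Finset.univ : Finset (Equiv.Perm (Fin 4))).val.map
      (fun π => (π 0, π 1, π 2, π 3)) =
      {(0, 1, 2, 3), (0, 1, 3, 2), (0, 2, 1, 3), (0, 2, 3, 1), (0, 3, 1, 2), (0, 3, 2, 1),
        (1, 0, 2, 3), (1, 0, 3, 2), (1, 2, 0, 3), (1, 2, 3, 0), (1, 3, 0, 2), (1, 3, 2, 0),
        (2, 0, 1, 3), (2, 0, 3, 1), (2, 1, 0, 3), (2, 1, 3, 0), (2, 3, 0, 1), (2, 3, 1, 0),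
        (3, 0, 1, 2), (3, 0, 2, 1), (3, 1, 0, 2), (3, 1, 2, 0), (3, 2, 0, 1), (3, 2, 1, 0)} := by
    decide +kernel
  have sum_eq := congrArg
    (fun s => (s.map fun p : Fin 4 × Fin 4 × Fin 4 × Fin 4 => f p.1 p.2.1 p.2.2.1 p.2.2.2).sum)
    map_univ_eq
  simp only [Multiset.map_map, Function.comp_def] at sum_eq
  rw [Finset.sum, sum_eq]
  simp [add_assoc]

/-- The sum over all permutations of the indices of a tensor with the two minor symmetries. -/
theorem sum_perm_of_minor_symm {ι : Type*} (T : ι → ι → ι → ι → ℝ)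
    (symm_left : ∀ i j k l, T i j k l = T j i k l)
    (symm_right : ∀ i j k l, T i j k l = T i j l k) (i j k l : ι) :
    ∑ π : Equiv.Perm (Fin 4),
        T (![i, j, k, l] (π 0)) (![i, j, k, l] (π 1))
          (![i, j, k, l] (π 2)) (![i, j, k, l] (π 3)) =
      4 * (T i j k l + T k l i j + T i k j l + T j l i k + T i l j k + T j k i l) := by
  rw [sum_perm_fin_four fun a b c d =>
    T (![i, j, k, l] a) (![i, j, k, l] b) (![i, j, k, l] c) (![i, j, k, l] d)]
  simp only [cons_val]
  grind

set_option maxHeartbeats 1000000 in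
/-- **Contraction of the harmonic square with a stress tensor.** Let `h` be a traceless
symmetric 3×3 matrix, `σ` a symmetric 3×3 matrix with deviator `σ′`, and let `H` be the total
symmetrization of `T_{ijkl} = h_{ij}h_{kl} − (4/7)δ_{ij}(h²)_{kl} + (2/35)tr(h²)δ_{ij}δ_{kl}`
(the harmonic square `h ∗ h`). Then
`σ : H : σ = (1/3)(tr(hσ′))² + (2/3)tr(σ′hσ′h) − (8/21)tr(h²σ′²) + (4/105)tr(h²)tr(σ′²)`. -/
theorem harmonic_square_contraction
    (h σ σ' : Matrix (Fin 3) (Fin 3) ℝ)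
    (hsym : h.IsSymm) (htr : h.trace = 0) (hσ : σ.IsSymm)
    (hσ' : σ' = σ - (σ.trace / 3) • (1 : Matrix (Fin 3) (Fin 3) ℝ))
    (T H : Fin 3 → Fin 3 → Fin 3 → Fin 3 → ℝ)
    (hT : ∀ i j k l, T i j k l =
      h i j * h k l - 4 / 7 * (if i = j then (1 : ℝ) else 0) * (h * h) k l
        + 2 / 35 * (h * h).trace * (if i = j then (1 : ℝ) else 0)
            * (if k = l then (1 : ℝ) else 0))
    (hH : ∀ i j k l, H i j k l = (1 / 24 : ℝ) *
      ∑ π : Equiv.Perm (Fin 4),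
        T (![i, j, k, l] (π 0)) (![i, j, k, l] (π 1))
          (![i, j, k, l] (π 2)) (![i, j, k, l] (π 3))) :
    ∑ i, ∑ j, ∑ k, ∑ l, H i j k l * σ i j * σ k l =
      1 / 3 * (h * σ').trace ^ 2 + 2 / 3 * (σ' * h * σ' * h).trace
        - 8 / 21 * (h * h * (σ' * σ')).trace
        + 4 / 105 * (h * h).trace * (σ' * σ').trace := by
  have hs : ∀ i j, h i j = h j i := fun i j => hsym.apply j i
  have hh : ∀ i j, (h * h) i j = (h * h) j i := fun i j => by
    simp only [mul_apply]
    exact Finset.sum_congr rfl fun m _ => by rw [hs i m, hs m j, mul_comm]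
  have symm_left : ∀ i j k l, T i j k l = T j i k l := fun i j k l => by
    rw [hT, hT, hs i j]; simp only [eq_comm]
  have symm_right : ∀ i j k l, T i j k l = T i j l k := fun i j k l => by
    rw [hT, hT, hs k l, hh k l]; simp only [eq_comm]
  have H_eq : ∀ i j k l, H i j k l =
      1 / 6 * (T i j k l + T k l i j + T i k j l + T j l i k + T i l j k + T j k i l) :=
    fun i j k l => by rw [hH, sum_perm_of_minor_symm T symm_left symm_right]; ring
  have h22 : h 2 2 = -h 0 0 - h 1 1 := by
    rw [trace_fin_three] at htr; linarith
  subst hσ'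
  simp only [H_eq, hT, Fin.sum_univ_three, Fin.isValue, Fin.reduceEq, if_true, if_false, mul_one,
    mul_zero, zero_mul, sub_zero, add_zero]
  simp only [trace_fin_three, Fin.sum_univ_three, mul_apply, Matrix.sub_apply, Matrix.smul_apply,
    one_apply, smul_eq_mul, Fin.isValue, Fin.reduceEq, if_true, if_false, mul_one, mul_zero,
    sub_zero, hs 1 0, hs 2 0, hs 2 1, hσ.apply 0 1, hσ.apply 0 2, hσ.apply 1 2, h22]
  ring
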